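/- Let θ be an A-signalizer functor on G. Then ⟨θ(a) : a ∈ A#⟩ = ⟨θ(b) ∩ C_G(B) : B a hyperplane of A, b ∈ B ∖ {1}⟩. -/

import Mathlib

open Pointwise

namespace PaperPF
set_option linter.unusedVariables false

/-- A subgroup `K` is subnormal if there is a finite chain
`K = K₀ ⊴ K₁ ⊴ ⋯ ⊴ Kₙ = G` with each term normal in the next. -/
def IsSubnormal {G : Type} [Group G] (K : Subgroup G) : Prop :=
  ∃ (n : ℕ) (c : Fin (n + 1) → Subgroup G),
    c 0 = K ∧ c (Fin.last n) = ⊤ ∧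
      ∀ i : Fin n, c i.castSucc ≤ c i.succ ∧ ((c i.castSucc).subgroupOf (c i.succ)).Normal

/-- A finite group is quasisimple if it is perfect and its central quotient is a
nonabelian simple group. -/
def IsQuasisimple (X : Type) [Group X] : Prop :=
  commutator X = ⊤ ∧ IsSimpleGroup (X ⧸ Subgroup.center X) ∧
    ∃ a b : X ⧸ Subgroup.center X, a * b ≠ b * a

/-- A component: a quasisimple subnormal subgroup. -/
def IsComponent {G : Type} [Group G] (K : Subgroup G) : Prop :=
  IsSubnormal K ∧ IsQuasisimple ↥K

/-- The subgroup generated by a family of subgroups. -/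
def genBy {G : Type} [Group G] (S : Set (Subgroup G)) : Subgroup G :=
  Subgroup.closure (⋃ N ∈ S, (N : Set G))

theorem genBy_normal {G : Type} [Group G] {S : Set (Subgroup G)}
    (h : ∀ N ∈ S, N.Normal) : (genBy S).Normal := by
  constructor
  intro x hx g
  have hmap : Subgroup.map (MulAut.conj g).toMonoidHom (genBy S) ≤ genBy S := by
    rw [genBy, MonoidHom.map_closure]
    apply Subgroup.closure_mono
    rintro y ⟨z, hz, rfl⟩
    simp only [Set.mem_iUnion] at hz ⊢
    obtain ⟨N, hN, hzN⟩ := hz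
    exact ⟨N, hN, (h N hN).conj_mem z hzN g⟩
  exact hmap ⟨x, hx, rfl⟩

/-- `O_𝒫(G)`: the subgroup generated by all normal `𝒫`-subgroups. -/
def Op (P : (X : Type) → [inst : Group X] → Prop) (G : Type) [Group G] : Subgroup G :=
  genBy {N : Subgroup G | N.Normal ∧ P ↥N}

instance Op_normal (P : (X : Type) → [inst : Group X] → Prop) (G : Type) [Group G] :
    (Op P G).Normal :=
  genBy_normal fun _ hN => hN.1

/-- `N` is normal with `𝒫` quotient. -/
def QuotIsP (P : (X : Type) → [inst : Group X] → Prop) {G : Type} [Group G]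
    (N : Subgroup G) : Prop :=
  ∃ h : N.Normal, haveI := h; P (G ⧸ N)

/-- `O^𝒫(G)`: the intersection of all normal subgroups with `𝒫` quotient. -/
def Oup (P : (X : Type) → [inst : Group X] → Prop) (G : Type) [Group G] : Subgroup G :=
  ⨅ (N : Subgroup G) (_ : QuotIsP P N), N

/-- A `𝒫`-component. -/
def IsPComponent (P : (X : Type) → [inst : Group X] → Prop) {G : Type} [Group G]
    (K : Subgroup G) : Prop :=
  IsSubnormal K ∧ IsQuasisimple (↥K ⧸ Op P ↥K) ∧ Oup P ↥K = ⊤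

/-- The solvable radical. -/
def solRad (G : Type) [Group G] : Subgroup G :=
  genBy {N : Subgroup G | N.Normal ∧ IsSolvable ↥N}

/-- `O_{𝒫,E}(G) = O_𝒫(G) · L_𝒫(G)`. -/
def OPE (P : (X : Type) → [inst : Group X] → Prop) (G : Type) [Group G] : Subgroup G :=
  Op P G ⊔ sSup {K : Subgroup G | IsPComponent P K}



/-- The subgroup of points fixed by a single element `a`. -/
def fixedBySub {A : Type} (G : Type) [Monoid A] [Group G] [MulDistribMulAction A G]
    (a : A) : Subgroup G where
  carrier := {x : G | a • x = x}
  one_mem' := smul_one a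
  mul_mem' := fun {x y} hx hy => by
    show a • (x * y) = x * y
    rw [smul_mul', hx, hy]
  inv_mem' := fun {x} hx => by
    show a • x⁻¹ = x⁻¹
    rw [smul_inv', hx]

/-- The subgroup of points fixed by every element of a subgroup `B` of `A`. -/
def fixedOfSub {A : Type} (G : Type) [Group A] [Group G] [MulDistribMulAction A G]
    (B : Subgroup A) : Subgroup G where
  carrier := {x : G | ∀ b ∈ B, b • x = x}
  one_mem' := fun b _ => smul_one b
  mul_mem' := fun {x y} hx hy b hb => by rw [smul_mul', hx b hb, hy b hb]
  inv_mem' := fun {x} hx b hb => by rw [smul_inv', hx b hb]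

/-- The action of `A` restricted to an `A`-invariant subgroup. -/
def invSubAction (A : Type) {G : Type} [Monoid A] [Group G] [MulDistribMulAction A G]
    (K : Subgroup G) (hK : ∀ (a : A) (x : G), x ∈ K → a • x ∈ K) :
    MulDistribMulAction A ↥K where
  smul a x := ⟨a • (x : G), hK a x x.2⟩
  one_smul x := Subtype.ext (one_smul A (x : G))
  mul_smul a b x := Subtype.ext (mul_smul a b (x : G))
  smul_mul a x y := Subtype.ext (smul_mul' a (x : G) (y : G))
  smul_one a := Subtype.ext (smul_one a)

/-- The map induced by `a • ·` on the quotient by an `A`-invariant normal subgroup. -/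
def invQuotSMul (A : Type) {G : Type} [Monoid A] [Group G] [MulDistribMulAction A G]
    (N : Subgroup G) [N.Normal] (hN : ∀ (a : A) (x : G), x ∈ N → a • x ∈ N) (a : A) :
    G ⧸ N → G ⧸ N :=
  Quotient.map' (a • ·) (fun x y h => by
    rw [QuotientGroup.leftRel_apply] at h ⊢
    have := hN a _ h
    rwa [smul_mul', smul_inv'] at this)

theorem invQuotSMul_mk (A : Type) {G : Type} [Monoid A] [Group G] [MulDistribMulAction A G]
    (N : Subgroup G) [N.Normal] (hN : ∀ (a : A) (x : G), x ∈ N → a • x ∈ N) (a : A) (x : G) :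
    invQuotSMul A N hN a (x : G ⧸ N) = ((a • x : G) : G ⧸ N) := rfl

/-- The action of `A` induced on the quotient by an `A`-invariant normal subgroup. -/
def invQuotAction (A : Type) {G : Type} [Monoid A] [Group G] [MulDistribMulAction A G]
    (N : Subgroup G) [N.Normal] (hN : ∀ (a : A) (x : G), x ∈ N → a • x ∈ N) :
    MulDistribMulAction A (G ⧸ N) where
  smul := invQuotSMul A N hN
  one_smul q := QuotientGroup.induction_on q fun x => by
    show invQuotSMul A N hN 1 (x : G ⧸ N) = (x : G ⧸ N)
    rw [invQuotSMul_mk, one_smul]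
  mul_smul a b q := QuotientGroup.induction_on q fun x => by
    show invQuotSMul A N hN (a * b) (x : G ⧸ N)
        = invQuotSMul A N hN a (invQuotSMul A N hN b (x : G ⧸ N))
    rw [invQuotSMul_mk, invQuotSMul_mk, invQuotSMul_mk, mul_smul]
  smul_mul a q r := Quotient.inductionOn₂' q r fun x y => by
    show invQuotSMul A N hN a ((x : G ⧸ N) * (y : G ⧸ N))
        = invQuotSMul A N hN a (x : G ⧸ N) * invQuotSMul A N hN a (y : G ⧸ N)
    rw [← QuotientGroup.mk_mul, invQuotSMul_mk, invQuotSMul_mk, invQuotSMul_mk,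
      ← QuotientGroup.mk_mul, smul_mul']
  smul_one a := by
    show invQuotSMul A N hN a ((1 : G) : G ⧸ N) = ((1 : G) : G ⧸ N)
    rw [invQuotSMul_mk, smul_one]

/-- The action of `A` induced on the central quotient. -/
def centerQuotAction (A : Type) (X : Type) [Group A] [Group X] [MulDistribMulAction A X] :
    MulDistribMulAction A (X ⧸ Subgroup.center X) :=
  invQuotAction A (Subgroup.center X) (fun a x hx => by
    rw [Subgroup.mem_center_iff] at hx ⊢
    intro y
    calc y * a • x = a • (a⁻¹ • y * x) := by rw [smul_mul', smul_inv_smul]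
    _ = a • (x * a⁻¹ • y) := by rw [hx (a⁻¹ • y)]
    _ = a • x * y := by rw [smul_mul', smul_inv_smul])


/-- `X` is `A`-quasisimple: it is generated by its components, the set of components
is nonempty, and `A` permutes the components transitively. -/
def IsAQuasisimple (A X : Type) [Group A] [Group X] [MulDistribMulAction A X] : Prop :=
  {K : Subgroup X | IsComponent K}.Nonempty ∧
  sSup {K : Subgroup X | IsComponent K} = ⊤ ∧
  ∀ K L : Subgroup X, IsComponent K → IsComponent L → ∃ a : A, a • K = L

/-- An `A`-component: the subgroup generated by an orbit of `A` on the components. -/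
def IsAComponent (A : Type) {G : Type} [Group A] [Group G] [MulDistribMulAction A G]
    (K : Subgroup G) : Prop :=
  ∃ L : Subgroup G, IsComponent L ∧ K = ⨆ a : A, a • L

/-- An `(A,𝒫)`-component: an `A`-invariant subnormal subgroup `K` with
`K = O^𝒫(K)` and `K/O_𝒫(K)` `A`-quasisimple under the induced action. -/
def IsAPComponent (P : (X : Type) → [inst : Group X] → Prop) (A : Type) {G : Type}
    [Group A] [Group G] [MulDistribMulAction A G] (K : Subgroup G) : Prop :=
  IsSubnormal K ∧ Oup P ↥K = ⊤ ∧
  ∃ hK : ∀ (a : A) (x : G), x ∈ K → a • x ∈ K,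
    letI := invSubAction A K hK
    ∃ hOp : ∀ (a : A) (x : ↥K), x ∈ Op P ↥K → a • x ∈ Op P ↥K,
      letI := invQuotAction A (Op P ↥K) hOp
      IsAQuasisimple A (↥K ⧸ Op P ↥K)

/-- The commutator `[X, t]` of a subgroup with an element acting on `G`;
the subgroup generated by all `x⁻¹ * (t • x)`, `x ∈ X`. -/
def commSub {A : Type} {G : Type} [Monoid A] [Group G] [MulDistribMulAction A G]
    (t : A) (X : Subgroup G) : Subgroup G :=
  Subgroup.closure {y : G | ∃ x ∈ X, y = x⁻¹ * (t • x)}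


/-- `O_{n𝒫}(G)`: the subgroup generated by all `A`-invariant normal subgroups whose
fixed-point subgroup under `A` is a `𝒫`-group. -/
def OnP (P : (X : Type) → [inst : Group X] → Prop) (A : Type) (G : Type) [Monoid A] [Group G]
    [MulDistribMulAction A G] : Subgroup G :=
  genBy {N : Subgroup G | N.Normal ∧ (∀ (a : A) (x : G), x ∈ N → a • x ∈ N) ∧
    P ↥(N ⊓ FixedPoints.subgroup A G)}

/-- The group-theoretic property "is solvable". -/
def solP : (X : Type) → [inst : Group X] → Prop := fun X _ => IsSolvable X

/-- If `A` acts irreducibly on an abelian group, then some subgroup of `A` of index `r` acts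
trivially: the image of `A` is a finite group of exponent `r` of units in a field. -/
theorem exists_index_eq_trivial_action_of_irreducible {r : ℕ} (hr : r.Prime) {A P : Type}
    [CommGroup A] [Finite A] (helem : ∀ a : A, a ^ r = 1) (hA : r ∣ Nat.card A)
    [CommGroup P] [MulDistribMulAction A P] [Nontrivial P]
    (hirr : ∀ N : Subgroup P, (∀ (a : A) (x : P), x ∈ N → a • x ∈ N) → N = ⊥ ∨ N = ⊤) :
    ∃ B : Subgroup A, B.index = r ∧ ∀ b ∈ B, ∀ x : P, b • x = x := by
  have := Fact.mk hr
  let ρ := Representation.ofMulDistribMulAction A P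
  let e : P → ρ.asModule := fun x => ρ.asModuleEquiv.symm (Additive.ofMul x)
  have he_inj : Function.Injective e := fun x y h => by
    simpa [e] using h
  have he_surj : Function.Surjective e := fun m =>
    ⟨Additive.toMul (ρ.asModuleEquiv m), by simp [e]⟩
  have he_mul (x y : P) : e (x * y) = e x + e y := by simp [e]
  have he_one : e 1 = 0 := by simp [e]
  have he_inv (x : P) : e x⁻¹ = -e x := by simp [e]
  have he_smul (a : A) (x : P) : e (a • x) = MonoidAlgebra.of ℤ A a • e x :=
    ρ.asModuleEquiv_symm_map_rho a (Additive.ofMul x)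
  have hsimple : IsSimpleModule (MonoidAlgebra ℤ A) ρ.asModule := by
    have : Nontrivial ρ.asModule := he_inj.nontrivial
    rw [isSimpleModule_iff]
    refine ⟨fun S => ?_⟩
    let N : Subgroup P :=
      { carrier := {x | e x ∈ S}
        one_mem' := by simp [he_one]
        mul_mem' := fun {x y} hx hy => by
          change e (x * y) ∈ S
          rw [he_mul]
          exact S.add_mem hx hy
        inv_mem' := fun {x} hx => by
          change e x⁻¹ ∈ S
          rw [he_inv]
          exact S.neg_mem hx }
    have hmem (x : P) : x ∈ N ↔ e x ∈ S := Iff.rfl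
    refine (hirr N fun a x hx => ?_).imp (fun h => ?_) (fun h => ?_)
    · rw [hmem, he_smul]
      exact S.smul_mem _ hx
    · refine (Submodule.eq_bot_iff S).2 fun m hm => ?_
      obtain ⟨x, rfl⟩ := he_surj m
      rw [← hmem, h, Subgroup.mem_bot] at hm
      rw [hm, he_one]
    · refine eq_top_iff.2 fun m _ => ?_
      obtain ⟨x, rfl⟩ := he_surj m
      rw [← hmem, h]
      trivial
  obtain ⟨I, hI, ⟨l⟩⟩ := isSimpleModule_iff_quot_maximal.1 hsimple
  let := Ideal.Quotient.field I
  let φ : A →* (MonoidAlgebra ℤ A ⧸ I)ˣ :=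
    (((Ideal.Quotient.mk I : MonoidAlgebra ℤ A →+* MonoidAlgebra ℤ A ⧸ I) :
      MonoidAlgebra ℤ A →* MonoidAlgebra ℤ A ⧸ I).comp (MonoidAlgebra.of ℤ A)).toHomUnits
  have hker : ∀ b ∈ φ.ker, ∀ x : P, b • x = x := fun b hb x => by
    apply he_inj
    apply l.injective
    rw [he_smul, map_smul]
    have hb' : Ideal.Quotient.mk I (MonoidAlgebra.of ℤ A b) = 1 :=
      congrArg Units.val (MonoidHom.mem_ker.1 hb)
    rw [Algebra.smul_def, Ideal.Quotient.algebraMap_eq, hb', one_mul]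
  have hdvd : φ.ker.index ∣ r := by
    rw [Subgroup.index_ker]
    have : Finite φ.range := Finite.of_surjective φ.rangeRestrict φ.rangeRestrict_surjective
    have : IsCyclic φ.range := isCyclic_subgroup_units φ.range
    rw [← IsCyclic.exponent_eq_card]
    refine Monoid.exponent_dvd_of_forall_pow_eq_one ?_
    rintro ⟨_, a, rfl⟩
    exact Subtype.ext ((map_pow φ a r).symm.trans (by rw [helem, map_one]; rfl))
  rcases (Nat.dvd_prime hr).1 hdvd with h | h
  · have hp : IsPGroup r A := fun a => ⟨1, by simpa using helem a⟩
    obtain ⟨n, hn⟩ := IsPGroup.iff_card.1 hp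
    have hn0 : n ≠ 0 := by
      rintro rfl
      rw [hn, pow_zero] at hA
      exact hr.one_lt.ne' (Nat.dvd_one.1 hA)
    obtain ⟨m, rfl⟩ := Nat.exists_eq_succ_of_ne_zero hn0
    obtain ⟨B, hB⟩ := Sylow.exists_subgroup_card_pow_prime (G := A) r (n := m)
      (hn ▸ pow_dvd_pow r m.le_succ)
    refine ⟨B, ?_, fun b _ => hker b (Subgroup.index_eq_one.1 h ▸ Subgroup.mem_top b)⟩
    have := B.card_mul_index
    rw [hB, hn, pow_succ] at this
    exact Nat.eq_of_mul_eq_mul_left (pow_pos hr.pos m) this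
  · exact ⟨φ.ker, h, hker⟩

/-- In a coprime action, fixed points of an invariant quotient lift to fixed points. -/
theorem exists_fixedOfSub_mk_eq {r : ℕ} (hr : r.Prime) {A K : Type} [CommGroup A] [Finite A]
    (helem : ∀ a : A, a ^ r = 1) [Group K] [Finite K] [MulDistribMulAction A K]
    (hK : ¬ r ∣ Nat.card K) (N : Subgroup K) [N.Normal]
    (hN : ∀ (a : A) (x : K), x ∈ N → a • x ∈ N) (B : Subgroup A) (q : K ⧸ N)
    (hq : ∀ b ∈ B, invQuotSMul A N hN b q = q) :
    ∃ x ∈ fixedOfSub K B, (x : K ⧸ N) = q := by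
  have := Fact.mk hr
  obtain ⟨y, rfl⟩ := QuotientGroup.mk_surjective q
  let X := {x : K // (x : K ⧸ N) = y}
  let : MulAction B X :=
    { smul := fun b x => ⟨(b : A) • (x : K), by
        rw [← invQuotSMul_mk A N hN, x.2]
        exact hq b b.2⟩
      one_smul := fun x => Subtype.ext (one_smul A (x : K))
      mul_smul := fun a b x => Subtype.ext (mul_smul (a : A) (b : A) (x : K)) }
  have hB : IsPGroup r B := fun b => ⟨1, Subtype.ext (by simpa using helem b)⟩
  have hcard : Nat.card X = Nat.card N :=
    Nat.card_congr
      { toFun := fun x => ⟨y⁻¹ * x, QuotientGroup.eq.1 x.2.symm⟩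
        invFun := fun n => ⟨y * n, QuotientGroup.mk_mul_of_mem y n.2⟩
        left_inv := fun x => by simp
        right_inv := fun n => by simp }
  obtain ⟨x, hx⟩ := hB.nonempty_fixed_point_of_prime_not_dvd_card X
    (fun h => hK ((hcard ▸ h).trans N.card_subgroup_dvd_card))
  exact ⟨x, fun b hb => congrArg Subtype.val (hx ⟨b, hb⟩), x.2⟩

/-- In a coprime action of an `r`-group, every prime has an invariant Sylow subgroup. -/
theorem exists_invariant_sylow {r : ℕ} (hr : r.Prime) {A K : Type} [CommGroup A] [Finite A]
    (helem : ∀ a : A, a ^ r = 1) [Group K] [Finite K] [MulDistribMulAction A K]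
    (hK : ¬ r ∣ Nat.card K) (p : ℕ) [Fact p.Prime] :
    ∃ P : Sylow p K, ∀ (a : A) (x : K), x ∈ P → a • x ∈ P := by
  have := Fact.mk hr
  have hA : IsPGroup r A := fun a => ⟨1, by simpa using helem a⟩
  obtain ⟨P⟩ := Sylow.nonempty (p := p) (G := K)
  obtain ⟨Q, hQ⟩ := hA.nonempty_fixed_point_of_prime_not_dvd_card (Sylow p K)
    (fun h => hK (h.trans (P.card_dvd_index.trans P.1.index_dvd_card)))
  refine ⟨Q, fun a x hx => ?_⟩
  have h : a • Q = Q := hQ a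
  rw [← h]
  exact Subgroup.smul_mem_pointwise_smul x a _ hx

/-- Coprime generation: a group on which an elementary abelian group acts coprimely is
generated by the fixed points of the hyperplanes. -/
theorem eq_top_of_forall_fixedOfSub_le {r : ℕ} (hr : r.Prime) {A : Type} [CommGroup A]
    [Finite A] (helem : ∀ a : A, a ^ r = 1) (hA : r ∣ Nat.card A) {K : Type} [Group K]
    [Finite K] [MulDistribMulAction A K] (hK : ¬ r ∣ Nat.card K) (H : Subgroup K)
    (hH : ∀ B : Subgroup A, B.index = r → fixedOfSub K B ≤ H) : H = ⊤ := by
  induction hn : Nat.card K using Nat.strong_induction_on generalizing K with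
  | _ n ih =>
  subst hn
  have hsub : ∀ N : Subgroup K, (∀ (a : A) (x : K), x ∈ N → a • x ∈ N) → N ≠ ⊤ → N ≤ H := by
    intro N hN hNtop
    let := invSubAction A N hN
    have hlt : Nat.card N < Nat.card K :=
      lt_of_le_of_ne N.card_le_card_group (fun h => hNtop (N.eq_top_of_card_eq h))
    exact Subgroup.subgroupOf_eq_top.1 <| ih _ hlt
      (fun h => hK (h.trans N.card_subgroup_dvd_card)) (H.subgroupOf N)
      (fun B hB x hx => hH B hB fun b hb => congrArg Subtype.val (hx b hb)) rfl
  have hquot : ∀ N : Subgroup K, N.Normal → (∀ (a : A) (x : K), x ∈ N → a • x ∈ N) →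
      N ≠ ⊥ → N ≠ ⊤ → H = ⊤ := by
    intro N hNn hN hNbot hNtop
    let := invQuotAction A N hN
    have hlt : Nat.card (K ⧸ N) < Nat.card K := by
      rw [← N.index_eq_card, ← N.card_mul_index]
      exact lt_mul_left (Nat.pos_of_ne_zero N.index_ne_zero_of_finite)
        (N.one_lt_card_iff_ne_bot.2 hNbot)
    have hmap := ih _ hlt (fun h => hK (h.trans N.card_quotient_dvd_card))
      (H.map (QuotientGroup.mk' N)) (fun B hB q hq => by
        obtain ⟨x, hx, rfl⟩ := exists_fixedOfSub_mk_eq hr helem hK N hN B q hq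
        exact ⟨x, hH B hB hx, rfl⟩) rfl
    have hcomap := congrArg (Subgroup.comap (QuotientGroup.mk' N)) hmap
    rwa [Subgroup.comap_map_eq, QuotientGroup.ker_mk', Subgroup.comap_top,
      sup_eq_left.2 (hsub N hN hNtop)] at hcomap
  by_cases hp : ∃ p, p.Prime ∧ IsPGroup p K
  · obtain ⟨p, hpp, hpK⟩ := hp
    have := Fact.mk hpp
    rcases subsingleton_or_nontrivial K with hs | hs
    · exact Subsingleton.elim _ _
    by_contra hne
    have hcenter : Subgroup.center K = ⊤ := by
      by_contra hc
      refine hne (hquot _ inferInstance (fun a x hx => ?_) hpK.bot_lt_center.ne' hc)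
      rw [Subgroup.mem_center_iff] at hx ⊢
      intro y
      have h := congrArg (a • ·) (hx (a⁻¹ • y))
      simpa only [smul_mul', smul_inv_smul] using h
    let : CommGroup K := Group.commGroupOfCenterEqTop hcenter
    obtain ⟨B, hB, hfix⟩ := exists_index_eq_trivial_action_of_irreducible hr (P := K) helem hA
      (fun N hN => by
        by_contra! h
        exact hne (hquot N inferInstance hN h.1 h.2))
    exact hne (eq_top_iff.2 fun x _ => hH B hB fun b hb => hfix b hb x)
  · refine H.eq_top_of_card_eq (Nat.dvd_antisymm H.card_subgroup_dvd_card ?_)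
    refine (Nat.dvd_iff_prime_pow_dvd_dvd _ _).2 fun p k hpp hk => ?_
    have := Fact.mk hpp
    obtain ⟨P, hP⟩ := exists_invariant_sylow hr helem hK p
    have hPH : (P : Subgroup K) ≤ H := hsub P hP fun h =>
      hp ⟨p, hpp, (P.2.of_equiv (MulEquiv.subgroupCongr h)).of_equiv Subgroup.topEquiv⟩
    refine dvd_trans ?_ (Subgroup.card_dvd_of_le hPH)
    rw [P.card_eq_multiplicity]
    exact pow_dvd_pow p ((hpp.pow_dvd_iff_le_factorization Nat.card_pos.ne').1 hk)

theorem statement_17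
    (r : ℕ) (hr : r.Prime) (A G : Type) [CommGroup A] [Group G] [Finite A] [Finite G]
    [MulDistribMulAction A G]
    (helem : ∀ a : A, a ^ r = 1)
    (hrank : ∃ f : Multiplicative (ZMod r × ZMod r × ZMod r) →* A, Function.Injective f)
    (θ : A → Subgroup G)
    (hfix : ∀ a : A, a ≠ 1 → θ a ≤ fixedBySub G a)
    (hinv : ∀ (a : A), a ≠ 1 → ∀ (b : A) (x : G), x ∈ θ a → b • x ∈ θ a)
    (hcop : ∀ a : A, a ≠ 1 → Nat.Coprime (Nat.card ↥(θ a)) (Nat.card A))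
    (hcomp : ∀ a b : A, a ≠ 1 → b ≠ 1 → θ a ⊓ fixedBySub G b ≤ θ b)
 :
    (⨆ (a : A) (_ : a ≠ 1), θ a)
      = ⨆ (B : Subgroup A) (_ : B.index = r) (b : A) (_ : b ∈ B) (_ : b ≠ 1),
          θ b ⊓ fixedOfSub G B := by
  obtain ⟨f, hf⟩ := hrank
  have := Fact.mk hr
  have hcard : r ^ 3 ∣ Nat.card A := by
    have h := Subgroup.card_dvd_of_injective f hf
    rwa [Nat.card_congr Multiplicative.toAdd, Nat.card_prod, Nat.card_prod, Nat.card_zmod,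
      show r * (r * r) = r ^ 3 by ring] at h
  have hrA : r ∣ Nat.card A := (dvd_pow_self r three_ne_zero).trans hcard
  apply le_antisymm
  · refine iSup₂_le fun a ha => ?_
    let := invSubAction A (θ a) (hinv a ha)
    refine Subgroup.subgroupOf_eq_top.1 (eq_top_of_forall_fixedOfSub_le hr helem hrA ?_ _ ?_)
    · exact fun h => hr.one_lt.ne' (Nat.eq_one_of_dvd_coprimes (hcop a ha) h hrA)
    · intro B hB x hx
      have hBbot : B ≠ ⊥ := by
        rintro rfl
        rw [Subgroup.index_bot] at hB
        rw [hB] at hcard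
        have h := Nat.le_of_dvd hr.pos hcard
        nlinarith [hr.two_le, pow_pos hr.pos 2, pow_succ r 2, pow_succ r 1, pow_one r]
      obtain ⟨b, hb, hb1⟩ := B.bot_or_exists_ne_one.resolve_left hBbot
      have hxB : (x : G) ∈ fixedOfSub G B := fun c hc => congrArg Subtype.val (hx c hc)
      have hle : θ b ⊓ fixedOfSub G B ≤ ⨆ (B : Subgroup A) (_ : B.index = r) (b : A)
          (_ : b ∈ B) (_ : b ≠ 1), θ b ⊓ fixedOfSub G B :=
        le_iSup_of_le B <| le_iSup_of_le hB <| le_iSup_of_le b <| le_iSup_of_le hb <|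
          le_iSup_of_le hb1 le_rfl
      exact hle ⟨hcomp a b ha hb1 ⟨x.2, hxB b hb⟩, hxB⟩
  · exact iSup₂_le fun B _ => iSup_le fun b => iSup₂_le fun _ hb1 =>
      inf_le_left.trans (le_iSup₂_of_le b hb1 le_rfl)

end PaperPF
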